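/- Let ε > 0, set σ := ‖Q‖ and π := ‖P⁻¹‖, and suppose ‖E_{x,i}‖ ≤ ε, ‖E_{Φ,i}‖ ≤ ε for all i ≥ 1 and ‖E_{r,i}‖ ≤ ε·π for all i ≥ 0. Then the second truncated Chebyshev iterate satisfies e₂ = ‖x̂₂ − x₂‖ ≤ ε·( 3 + |α₁|·σ + ( |α₁| + (1 + |β₁| + |α₁|·σ)/|d| )·π ). -/

import Mathlib

/-- With truncation accuracy ε (and `‖E_{r,i}‖ ≤ ε·π`), the second
truncated Chebyshev iterate satisfies
`e₂ ≤ ε(3 + |α₁|σ + (|α₁| + (1 + |β₁| + |α₁|σ)/|d|)π)`. -/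
theorem chebyshevT_error_bound_two (n : ℕ)
    (A : EuclideanSpace ℝ (Fin n) →L[ℝ] EuclideanSpace ℝ (Fin n))
    (P : EuclideanSpace ℝ (Fin n) ≃L[ℝ] EuclideanSpace ℝ (Fin n))
    (Q : EuclideanSpace ℝ (Fin n) →L[ℝ] EuclideanSpace ℝ (Fin n))
    (hQ : Q = (P.symm : EuclideanSpace ℝ (Fin n) →L[ℝ] EuclideanSpace ℝ (Fin n)).comp A)
    (b : EuclideanSpace ℝ (Fin n)) (d : ℝ) (hd : d ≠ 0)
    (α β : ℕ → ℝ)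
    (x r Φ : ℕ → EuclideanSpace ℝ (Fin n))
    (xhat rhat Φhat : ℕ → EuclideanSpace ℝ (Fin n))
    (Er EΦ Ex : ℕ → EuclideanSpace ℝ (Fin n))
    (hr : ∀ i, r i = P.symm (b - A (x i)))
    (hΦ0 : Φ 0 = (1 / d) • r 0)
    (hΦ : ∀ i, 1 ≤ i → Φ i = α i • r i + β i • Φ (i - 1))
    (hx : ∀ i, x (i + 1) = x i + Φ i)
    (hxhat0 : xhat 0 = x 0)
    (hrhat : ∀ i, rhat i = P.symm (b - A (xhat i)) + Er i)
    (hΦhat0 : Φhat 0 = (1 / d) • rhat 0)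
    (hΦhat : ∀ i, 1 ≤ i → Φhat i = α i • rhat i + β i • Φhat (i - 1) + EΦ i)
    (hxhat : ∀ i, xhat (i + 1) = xhat i + Φhat i + Ex (i + 1))
    (σ π : ℝ)
    (hσ : σ = ‖Q‖)
    (hπ : π = ‖(P.symm : EuclideanSpace ℝ (Fin n) →L[ℝ] EuclideanSpace ℝ (Fin n))‖)
    (ε : ℝ) (hε : 0 < ε)
    (hEx : ∀ i, 1 ≤ i → ‖Ex i‖ ≤ ε)
    (hEΦ : ∀ i, 1 ≤ i → ‖EΦ i‖ ≤ ε)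
    (hEr : ∀ i, ‖Er i‖ ≤ ε * π) :
    ‖xhat 2 - x 2‖ ≤
      ε * (3 + |α 1| * σ + (|α 1| + (1 + |β 1| + |α 1| * σ) / |d|) * π) := by
  have hΦ0_err : Φhat 0 - Φ 0 = (1 / d) • Er 0 := by
    rw [hΦhat0, hΦ0, hrhat, hr, hxhat0, ← smul_sub, add_sub_cancel_left]
  have hx1_err : xhat 1 - x 1 = (1 / d) • Er 0 + Ex 1 := by
    rw [← hΦ0_err, hxhat 0, hx 0, hxhat0]
    abel
  have hr1_err : rhat 1 - r 1 = Er 1 - Q (xhat 1 - x 1) := by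
    simp only [hrhat, hr, hQ, ContinuousLinearMap.comp_apply, ContinuousLinearEquiv.coe_coe,
      map_sub]
    abel
  have hΦ1_err : Φhat 1 - Φ 1 = α 1 • (rhat 1 - r 1) + β 1 • (Φhat 0 - Φ 0) + EΦ 1 := by
    rw [hΦhat 1 le_rfl, hΦ 1 le_rfl, smul_sub, smul_sub]
    abel
  have hx2_err : xhat 2 - x 2 = (xhat 1 - x 1) + (Φhat 1 - Φ 1) + Ex 2 := by
    rw [hxhat 1, hx 1]
    abel
  have hΦ0_norm : ‖Φhat 0 - Φ 0‖ ≤ ε * π / |d| := by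
    rw [hΦ0_err, norm_smul, Real.norm_eq_abs, abs_div, abs_one, one_div_mul_eq_div]
    gcongr
    exact hEr 0
  have hx1_norm : ‖xhat 1 - x 1‖ ≤ ε * π / |d| + ε := by
    rw [hx1_err, ← hΦ0_err]
    exact norm_add_le_of_le hΦ0_norm (hEx 1 le_rfl)
  have hr1_norm : ‖rhat 1 - r 1‖ ≤ ε * π + σ * (ε * π / |d| + ε) := by
    rw [hr1_err, hσ]
    exact norm_sub_le_of_le (hEr 1) (Q.le_opNorm_of_le hx1_norm)
  have hΦ1_norm : ‖Φhat 1 - Φ 1‖ ≤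
      |α 1| * (ε * π + σ * (ε * π / |d| + ε)) + |β 1| * (ε * π / |d|) + ε := by
    rw [hΦ1_err]
    refine norm_add_le_of_le (norm_add_le_of_le ?_ ?_) (hEΦ 1 le_rfl)
    · rw [norm_smul, Real.norm_eq_abs]
      gcongr
    · rw [norm_smul, Real.norm_eq_abs]
      gcongr
  calc ‖xhat 2 - x 2‖
      ≤ (ε * π / |d| + ε) + (|α 1| * (ε * π + σ * (ε * π / |d| + ε)) +
          |β 1| * (ε * π / |d|) + ε) + ε := by
        rw [hx2_err]
        exact norm_add_le_of_le (norm_add_le_of_le hx1_norm hΦ1_norm) (hEx 2 one_le_two)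
    _ = ε * (3 + |α 1| * σ + (|α 1| + (1 + |β 1| + |α 1| * σ) / |d|) * π) := by ring
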